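/- ∫_0^{π/2} ln(x² + ln²(2 cos x)) · cos(2x) dx = −π/4. -/

import Mathlib

open Real

/-- `log (1+z) / z`, extended by `1` at the origin. -/
noncomputable def auxL (z : ℂ) : ℂ := if z = 0 then 1 else Complex.log (1 + z) / z

/-- the analytic function `log (log (1+z) / z)`. -/
noncomputable def auxG (z : ℂ) : ℂ := Complex.log (auxL z)

lemma aux_re_pos {z : ℂ} (hz : ‖z‖ ≤ 1) (hz1 : z ≠ -1) : 0 < 1 + z.re := by
  have h := Complex.sq_norm z
  rw [Complex.normSq_apply] at h
  have h2 : ‖z‖ ^ 2 ≤ 1 := by nlinarith [norm_nonneg z]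
  by_contra hc
  push Not at hc
  have h3 : z.re = -1 := by nlinarith [mul_self_nonneg z.im]
  have h4 : z.im = 0 := by
    rw [h3] at h
    have : z.im * z.im = 0 := le_antisymm (by nlinarith) (mul_self_nonneg _)
    simpa using this
  apply hz1
  apply Complex.ext <;> simp [h3, h4]

lemma aux_slit {z : ℂ} (hz : ‖z‖ ≤ 1) (hz1 : z ≠ -1) : 1 + z ∈ Complex.slitPlane := by
  left
  simpa using aux_re_pos hz hz1

lemma aux_inv_re {z : ℂ} (hz : ‖z‖ ≤ 1) (hz1 : z ≠ -1) : 1 / 2 ≤ ((1 + z)⁻¹).re := by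
  have h0 := aux_re_pos hz hz1
  have h := Complex.sq_norm z
  rw [Complex.normSq_apply] at h
  have h2 : ‖z‖ ^ 2 ≤ 1 := by nlinarith [norm_nonneg z]
  rw [Complex.inv_re, Complex.normSq_apply]
  simp only [Complex.add_re, Complex.one_re, Complex.add_im, Complex.one_im, zero_add]
  rw [le_div_iff₀ (by nlinarith [mul_self_nonneg z.im, mul_pos h0 h0])]
  nlinarith

lemma auxL_re {z : ℂ} (hz : ‖z‖ ≤ 1) (hz1 : z ≠ -1) : 1 / 2 ≤ (auxL z).re := by
  unfold auxL
  split_ifs with h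
  · norm_num
  · have hs := aux_slit hz hz1
    rw [Complex.log_eq_integral hs, mul_div_cancel_left₀ _ h]
    have hc := Complex.continuousOn_one_add_mul_inv hs
    have hi : IntervalIntegrable (fun t : ℝ ↦ (1 + t • z)⁻¹) MeasureTheory.volume 0 1 := by
      apply ContinuousOn.intervalIntegrable
      rwa [Set.uIcc_of_le zero_le_one]
    have hre : (∫ t in (0:ℝ)..1, (1 + t • z)⁻¹).re = ∫ t in (0:ℝ)..1, ((1 + t • z)⁻¹).re := by
      have := Complex.reCLM.intervalIntegral_comp_comm hi
      simpa using this.symm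
    rw [hre]
    have hi' : IntervalIntegrable (fun t : ℝ ↦ ((1 + t • z)⁻¹).re) MeasureTheory.volume 0 1 := by
      apply ContinuousOn.intervalIntegrable
      rw [Set.uIcc_of_le zero_le_one]
      exact Complex.continuous_re.comp_continuousOn hc
    have := intervalIntegral.integral_mono_on (f := fun _ : ℝ => (1/2 : ℝ)) zero_le_one
      (by simp) hi' (fun t ht => ?_)
    · simpa using this
    · have hn : ‖t • z‖ ≤ 1 := by
        rw [norm_smul, Real.norm_of_nonneg ht.1]
        nlinarith [ht.1, ht.2, norm_nonneg z]
      refine aux_inv_re hn ?_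
      intro hh
      rcases eq_or_lt_of_le ht.2 with h1 | h1
      · rw [h1, one_smul] at hh; exact hz1 hh
      · have := congrArg norm hh
        rw [norm_smul, Real.norm_of_nonneg ht.1] at this
        simp at this
        nlinarith [ht.1, norm_nonneg z]

lemma auxL_slit {z : ℂ} (hz : ‖z‖ ≤ 1) (hz1 : z ≠ -1) : auxL z ∈ Complex.slitPlane :=
  Or.inl (by linarith [auxL_re hz hz1])

lemma auxL_norm {z : ℂ} (hz : ‖z‖ ≤ 1) (hz1 : z ≠ -1) : 1 / 2 ≤ ‖auxL z‖ :=
  (auxL_re hz hz1).trans (Complex.re_le_norm _)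

lemma auxL_deriv_zero : HasDerivAt auxL (-1/2) 0 := by
  rw [hasDerivAt_iff_isLittleO_nhds_zero]
  have hO := Complex.log_sub_logTaylor_isBigO 2
  have h1 : (fun h : ℂ => auxL (0 + h) - auxL 0 - h • (-1/2 : ℂ)) =O[nhds 0] fun h : ℂ => h ^ 2 := by
    obtain ⟨C, hC⟩ := hO.bound
    refine Asymptotics.IsBigO.of_bound C ?_
    filter_upwards [hC] with z hz
    by_cases h0 : z = 0
    · simp [h0]
    · have : auxL (0 + z) - auxL 0 - z • (-1/2 : ℂ) =
          (Complex.log (1 + z) - Complex.logTaylor (2 + 1) z) / z := by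
        simp [auxL, h0, Complex.logTaylor, Finset.sum_range_succ]
        field_simp
        ring
      rw [this, norm_div, div_le_iff₀ (norm_pos_iff.2 h0)]
      calc _ ≤ _ := hz
        _ = _ := by rw [norm_pow, norm_pow]; ring
  refine h1.trans_isLittleO ?_
  simpa using Asymptotics.isLittleO_pow_pow (𝕜 := ℂ) (m := 1) (n := 2) (by norm_num)

lemma auxL_diff {z : ℂ} (hz : ‖z‖ ≤ 1) (hz1 : z ≠ -1) : DifferentiableAt ℂ auxL z := by
  by_cases h : z = 0
  · rw [h]; exact auxL_deriv_zero.differentiableAt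
  · have hs := aux_slit hz hz1
    have h1 : DifferentiableAt ℂ (fun z => Complex.log (1 + z) / z) z :=
      (DifferentiableAt.clog (by fun_prop) hs).div differentiableAt_id h
    refine h1.congr_of_eventuallyEq ?_
    filter_upwards [isOpen_ne.mem_nhds h] with w hw
    simp only [auxL, if_neg hw]

lemma auxG_diff {z : ℂ} (hz : ‖z‖ ≤ 1) (hz1 : z ≠ -1) : DifferentiableAt ℂ auxG z :=
  (auxL_diff hz hz1).clog (auxL_slit hz hz1)

lemma auxG_deriv : deriv auxG 0 = -1/2 := by
  have h0 : auxL 0 = 1 := by simp [auxL]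
  have := auxL_deriv_zero.clog (by rw [h0]; simp)
  rw [h0] at this
  have h2 := this.deriv
  rw [div_one] at h2
  exact h2

lemma ne_neg_one_of_lt {z : ℂ} (h : ‖z‖ < 1) : z ≠ -1 := by
  rintro rfl
  simp at h

lemma auxG_circle {r : ℝ} (h0 : 0 < r) (h1 : r < 1) :
    ∫ θ in (0:ℝ)..(2 * π), auxG (circleMap 0 r θ) * (Real.cos θ : ℂ) = -(r * π / 2 : ℂ) := by
  have hd : DifferentiableOn ℂ auxG (Metric.closedBall 0 r) := by
    intro z hz
    have : ‖z‖ ≤ r := by simpa using hz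
    exact (auxG_diff (this.trans h1.le) (ne_neg_one_of_lt (this.trans_lt h1))).differentiableWithinAt
  have hcont : Continuous (fun θ : ℝ => auxG (circleMap 0 r θ)) :=
    hd.continuousOn.comp_continuous (continuous_circleMap 0 r)
      (fun θ => circleMap_mem_closedBall 0 h0.le θ)
  have hne : ∀ θ, circleMap 0 r θ ≠ 0 := fun θ => circleMap_ne_center h0.ne'
  have A := hd.deriv_eq_smul_circleIntegral h0
  have B : ∮ z in C(0, r), auxG z = 0 :=
    (hd.mono Metric.closure_ball_subset_closedBall).diffContOnCl.circleIntegral_eq_zero h0.le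
  rw [auxG_deriv] at A
  simp only [circleIntegral, deriv_circleMap, sub_zero, smul_eq_mul] at A B
  have key : ∀ θ : ℝ, auxG (circleMap 0 r θ) * (Real.cos θ : ℂ) =
      (1 / (2 * r * Complex.I)) * (circleMap 0 r θ * Complex.I * auxG (circleMap 0 r θ)) +
      (r / (2 * Complex.I)) * (circleMap 0 r θ * Complex.I *
        (1 / circleMap 0 r θ ^ 2 * auxG (circleMap 0 r θ))) := by
    intro θ
    have hr : (r : ℂ) ≠ 0 := by exact_mod_cast h0.ne'
    have hc : (Real.cos θ : ℂ) = (circleMap 0 r θ / r + r / circleMap 0 r θ) / 2 := by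
      simp only [circleMap, zero_add, Complex.ofReal_cos, Complex.cos]
      rw [mul_div_cancel_left₀ _ hr, neg_mul, Complex.exp_neg]
      field_simp
    have := hne θ
    rw [hc]
    field_simp
  simp only [key]
  rw [intervalIntegral.integral_add, intervalIntegral.integral_const_mul,
    intervalIntegral.integral_const_mul, A, B]
  · have hr : (r : ℂ) ≠ 0 := by exact_mod_cast h0.ne'
    field_simp
    simp
  · apply Continuous.intervalIntegrable
    fun_prop
  · apply Continuous.intervalIntegrable
    have : Continuous fun θ : ℝ => 1 / circleMap 0 r θ ^ 2 :=
      continuous_const.div (by fun_prop) (fun θ => pow_ne_zero _ (hne θ))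
    fun_prop

lemma norm_one_add_circle {r θ : ℝ} (hr : 1 / 2 ≤ r) :
    |Real.cos (1 / 2 * θ)| ≤ ‖1 + circleMap 0 r θ‖ := by
  refine abs_le_of_sq_le_sq ?_ (norm_nonneg _)
  rw [Complex.sq_norm, Complex.normSq_apply]
  have hre : (1 + circleMap 0 r θ).re = 1 + r * Real.cos θ := by simp [circleMap]
  have him : (1 + circleMap 0 r θ).im = r * Real.sin θ := by simp [circleMap]
  rw [hre, him]
  have h2 : Real.cos θ = 2 * Real.cos (1 / 2 * θ) ^ 2 - 1 := by
    rw [← Real.cos_two_mul]; ring_nf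
  have h3 := Real.sin_sq_add_cos_sq θ
  have h4 : (1 + r * Real.cos θ) * (1 + r * Real.cos θ) + r * Real.sin θ * (r * Real.sin θ)
      = 1 + 2 * r * Real.cos θ + r ^ 2 := by
    linear_combination r ^ 2 * h3
  rw [h4, h2]
  nlinarith [sq_nonneg (1 - r), sq_nonneg (Real.cos (1 / 2 * θ))]

lemma auxG_bound {r θ : ℝ} (hr : 1 / 2 ≤ r) (hr1 : r ≤ 1) (hθ : Real.cos (1 / 2 * θ) ≠ 0) :
    ‖auxG (circleMap 0 r θ)‖ ≤
      (Real.log 2 + 2 * (|Real.log (Real.cos (1 / 2 * θ))| + Real.log 2 + π)) + π := by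
  set z := circleMap 0 r θ with hzdef
  have hc := norm_one_add_circle (θ := θ) hr
  rw [← hzdef] at hc
  have hcp : 0 < |Real.cos (1 / 2 * θ)| := abs_pos.2 hθ
  have hzn : ‖z‖ = r := by rw [hzdef]; simp [abs_of_nonneg (by linarith : 0 ≤ r)]
  have hz : ‖z‖ ≤ 1 := by linarith
  have hz1 : z ≠ -1 := by
    intro h; rw [h] at hc; simp at hc; exact hθ (by simpa using hc)
  have hlog2 : 0 < Real.log 2 := Real.log_pos (by norm_num)
  have nl : ∀ w : ℂ, ‖Complex.log w‖ ≤ |Real.log ‖w‖| + π := by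
    intro w
    refine (Complex.norm_le_abs_re_add_abs_im _).trans ?_
    rw [Complex.log_re, Complex.log_im]
    gcongr
    exact Complex.abs_arg_le_pi w
  have hL := auxL_norm hz hz1
  have h1 : |Real.log ‖1 + z‖| ≤ |Real.log (Real.cos (1 / 2 * θ))| + Real.log 2 := by
    have hup : ‖1 + z‖ ≤ 2 := (norm_add_le _ _).trans (by simp; linarith)
    have a := Real.log_le_log (hcp.trans_le hc) hup
    have b := Real.log_le_log hcp hc
    rw [Real.log_abs] at b
    rw [abs_le]
    constructor
    · linarith [neg_abs_le (Real.log (Real.cos (1 / 2 * θ)))]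
    · linarith [abs_nonneg (Real.log (Real.cos (1 / 2 * θ)))]
  have h2 : ‖auxL z‖ ≤ 2 * (|Real.log (Real.cos (1 / 2 * θ))| + Real.log 2 + π) := by
    have hz0 : z ≠ 0 := norm_pos_iff.1 (by linarith)
    rw [auxL, if_neg hz0, norm_div, hzn, div_le_iff₀ (by linarith)]
    have := nl (1 + z)
    nlinarith [norm_nonneg (Complex.log (1 + z))]
  refine (nl _).trans ?_
  gcongr
  rw [abs_le]
  have hlow := Real.log_le_log (by norm_num) hL
  rw [one_div, Real.log_inv] at hlow
  have hhi := Real.log_le_self (norm_nonneg (auxL z))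
  constructor
  · linarith [norm_nonneg (auxL z)]
  · linarith

lemma cos_half_ne : ∀ᵐ θ : ℝ, θ ∈ Set.uIoc 0 (2 * π) → Real.cos (1 / 2 * θ) ≠ 0 := by
  have : ∀ᵐ θ : ℝ, θ ≠ π := by simp [MeasureTheory.ae_iff]
  filter_upwards [this] with θ h hm hc
  rw [Set.uIoc_of_le (by positivity)] at hm
  have h1 := (Real.injOn_cos : Set.InjOn Real.cos (Set.Icc 0 π)) (show 1 / 2 * θ ∈ Set.Icc 0 π from
    ⟨by linarith [hm.1], by linarith [hm.2]⟩)
    (show π / 2 ∈ Set.Icc 0 π from ⟨by positivity, by linarith [Real.pi_pos]⟩)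
    (by rw [hc, Real.cos_pi_div_two])
  exact h (by linarith)

lemma ne_neg_one_of_cos {θ : ℝ} (h : Real.cos (1 / 2 * θ) ≠ 0) : circleMap 0 1 θ ≠ -1 := by
  intro hh
  have hc := norm_one_add_circle (r := 1) (θ := θ) (by norm_num)
  rw [hh] at hc; simp at hc; exact h (by simpa using hc)

lemma auxG_boundary :
    ∫ θ in (0:ℝ)..(2 * π), auxG (circleMap 0 1 θ) * (Real.cos θ : ℂ) = -(π / 2 : ℂ) := by
  have hlim : Filter.Tendsto (fun r : ℝ => ∫ θ in (0:ℝ)..(2 * π),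
      auxG (circleMap 0 r θ) * (Real.cos θ : ℂ)) (nhdsWithin 1 (Set.Iio 1))
      (nhds (∫ θ in (0:ℝ)..(2 * π), auxG (circleMap 0 1 θ) * (Real.cos θ : ℂ))) := by
    have hmem : ∀ᶠ r : ℝ in nhdsWithin 1 (Set.Iio 1), r ∈ Set.Ioo (1/2 : ℝ) 1 :=
      Ioo_mem_nhdsLT (by norm_num)
    refine intervalIntegral.tendsto_integral_filter_of_dominated_convergence
      (fun θ => (Real.log 2 + 2 * (|Real.log (Real.cos (1 / 2 * θ))| + Real.log 2 + π)) + π)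
      ?_ ?_ ?_ ?_
    · filter_upwards [hmem] with r hr
      apply Continuous.aestronglyMeasurable
      refine Continuous.mul ?_ (by fun_prop)
      rw [continuous_iff_continuousAt]
      intro θ
      have hn : ‖circleMap 0 r θ‖ < 1 := by
        simp [abs_of_nonneg (by linarith [hr.1] : (0:ℝ) ≤ r), hr.2]
      exact ContinuousAt.comp (f := fun θ => circleMap 0 r θ)
        (auxG_diff hn.le (ne_neg_one_of_lt hn)).continuousAt
        (continuous_circleMap 0 r).continuousAt
    · filter_upwards [hmem] with r hr
      filter_upwards [cos_half_ne] with θ h hm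
      rw [norm_mul]
      have := auxG_bound hr.1.le hr.2.le (h hm)
      have hcos : ‖(Real.cos θ : ℂ)‖ ≤ 1 := by
        rw [Complex.norm_real]; exact Real.abs_cos_le_one θ
      nlinarith [norm_nonneg (auxG (circleMap 0 r θ))]
    · have h0 : IntervalIntegrable (fun θ => Real.log (Real.cos (1 / 2 * θ)))
          MeasureTheory.volume 0 (2 * π) := by
        have := (intervalIntegrable_log_cos (a := 0) (b := π)).comp_mul_left (c := 1 / 2)
        simpa [Function.comp_def, mul_comm] using this
      have hk : ∀ c : ℝ, IntervalIntegrable (fun _ : ℝ => c) MeasureTheory.volume 0 (2 * π) :=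
        fun c => by simp
      exact ((hk _).add (((h0.abs.add (hk _)).add (hk _)).const_mul 2)).add (hk _)
    · filter_upwards [cos_half_ne] with θ h hm
      refine Filter.Tendsto.mul_const _ ?_
      have hn : ‖circleMap 0 1 θ‖ ≤ 1 := by simp
      have hg := (auxG_diff hn (ne_neg_one_of_cos (h hm))).continuousAt
      have hcm : Continuous (fun r : ℝ => circleMap 0 r θ) := by
        unfold circleMap; fun_prop
      exact Filter.Tendsto.comp (g := auxG) hg ((hcm.tendsto 1).mono_left nhdsWithin_le_nhds)
  have hlim2 : Filter.Tendsto (fun r : ℝ => ∫ θ in (0:ℝ)..(2 * π),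
      auxG (circleMap 0 r θ) * (Real.cos θ : ℂ)) (nhdsWithin 1 (Set.Iio 1))
      (nhds (-(π / 2 : ℂ))) := by
    have hc : Filter.Tendsto (fun r : ℝ => -(r * π / 2 : ℂ)) (nhdsWithin 1 (Set.Iio 1))
        (nhds (-(π / 2 : ℂ))) := by
      have : Continuous (fun r : ℝ => -(r * π / 2 : ℂ)) := by fun_prop
      have := (this.tendsto 1).mono_left (nhdsWithin_le_nhds (s := Set.Iio 1))
      simpa using this
    refine hc.congr' ?_
    filter_upwards [Ioo_mem_nhdsLT (show (1/2:ℝ) < 1 by norm_num)] with r hr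
    rw [auxG_circle (by linarith [hr.1]) hr.2]
  exact tendsto_nhds_unique hlim hlim2

/-- the real boundary integrand -/
noncomputable def auxH (θ : ℝ) : ℝ :=
  Real.log ‖Complex.log (1 + circleMap 0 1 θ)‖ * Real.cos θ

lemma auxH_re (θ : ℝ) : (auxG (circleMap 0 1 θ) * (Real.cos θ : ℂ)).re = auxH θ := by
  have h0 : circleMap 0 1 θ ≠ 0 := circleMap_ne_center one_ne_zero
  rw [Complex.re_mul_ofReal, auxG, Complex.log_re, auxL, if_neg h0, norm_div, auxH]
  simp

lemma auxH_symm (θ : ℝ) (h : Real.cos (1 / 2 * θ) ≠ 0) : auxH (2 * π - θ) = auxH θ := by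
  have h1 : circleMap 0 1 (2 * π - θ) = (starRingEnd ℂ) (circleMap 0 1 θ) := by
    apply Complex.ext <;> simp [circleMap, Complex.exp_re, Complex.exp_im, Real.cos_two_pi_sub,
      Real.sin_two_pi_sub]
  have hs : 1 + circleMap 0 1 θ ∈ Complex.slitPlane :=
    aux_slit (by simp) (ne_neg_one_of_cos h)
  unfold auxH
  rw [h1, Real.cos_two_pi_sub]
  have h2 : (1 : ℂ) + (starRingEnd ℂ) (circleMap 0 1 θ) = (starRingEnd ℂ) (1 + circleMap 0 1 θ) := by
    simp
  rw [h2, Complex.log_conj _ (Complex.slitPlane_arg_ne_pi hs), Complex.norm_conj]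

lemma auxH_half : ∫ θ in (0:ℝ)..π, auxH θ = -π / 4 := by
  have hB := auxG_boundary
  have hi : IntervalIntegrable (fun θ : ℝ => auxG (circleMap 0 1 θ) * (Real.cos θ : ℂ))
      MeasureTheory.volume 0 (2 * π) := by
    apply intervalIntegral.intervalIntegrable_of_integral_ne_zero
    rw [hB]
    simp [Real.pi_ne_zero]
  have hre : ∫ θ in (0:ℝ)..(2 * π), auxH θ = -π / 2 := by
    have := Complex.reCLM.intervalIntegral_comp_comm hi
    rw [hB] at this
    simp only [Complex.reCLM_apply, auxH_re] at this
    rw [this]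
    have : (-(π / 2 : ℂ)) = ((-π / 2 : ℝ) : ℂ) := by push_cast; ring
    rw [this, Complex.ofReal_re]
  have hiH : IntervalIntegrable auxH MeasureTheory.volume 0 (2 * π) := by
    apply intervalIntegral.intervalIntegrable_of_integral_ne_zero
    rw [hre]
    have := Real.pi_pos
    intro h
    linarith
  have hp := Real.pi_pos
  have hs := intervalIntegral.integral_add_adjacent_intervals (a := 0) (b := π) (c := 2 * π)
    (hiH.mono_set (by
      rw [Set.uIcc_of_le hp.le, Set.uIcc_of_le (by linarith)]
      exact Set.Icc_subset_Icc le_rfl (by linarith)))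
    (hiH.mono_set (by
      rw [Set.uIcc_of_le (by linarith), Set.uIcc_of_le (by linarith)]
      exact Set.Icc_subset_Icc hp.le le_rfl))
  have hsymm : ∫ θ in (0:ℝ)..π, auxH θ = ∫ θ in π..(2 * π), auxH θ := by
    have h1 := intervalIntegral.integral_comp_sub_left (a := 0) (b := π) auxH (2 * π)
    rw [show 2 * π - π = π by ring, sub_zero] at h1
    rw [← h1]
    apply intervalIntegral.integral_congr_ae
    filter_upwards [cos_half_ne] with θ h hm
    refine (auxH_symm θ (h ?_)).symm
    rw [Set.uIoc_of_le hp.le] at hm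
    rw [Set.uIoc_of_le (by linarith)]
    exact ⟨hm.1, by linarith [hm.2]⟩
  linarith

lemma aux_integrand {x : ℝ} (h0 : 0 < x) (h1 : x < π / 2) :
    Real.log (x ^ 2 + Real.log (2 * Real.cos x) ^ 2) * Real.cos (2 * x) = 2 * auxH (2 * x) := by
  have hc : 0 < Real.cos x := Real.cos_pos_of_mem_Ioo ⟨by linarith, h1⟩
  have e1 : 1 + circleMap 0 1 (2 * x) = ((2 * Real.cos x : ℝ) : ℂ) * Complex.exp (x * Complex.I) := by
    have : circleMap 0 1 (2 * x) = Complex.exp (x * Complex.I) * Complex.exp (x * Complex.I) := by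
      rw [← Complex.exp_add]; simp [circleMap]; ring_nf
    rw [this]
    push_cast
    rw [Complex.two_cos, add_mul, ← Complex.exp_add (-x * Complex.I)]
    simp [add_comm]
  have e2 : Complex.log (1 + circleMap 0 1 (2 * x)) = (Real.log (2 * Real.cos x) : ℂ) + x * Complex.I := by
    rw [e1, Complex.log_ofReal_mul (by positivity) (Complex.exp_ne_zero _), Complex.log_exp]
    · simp; linarith
    · simp; linarith
  have e3 : ‖Complex.log (1 + circleMap 0 1 (2 * x))‖ ^ 2 = x ^ 2 + Real.log (2 * Real.cos x) ^ 2 := by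
    rw [e2, Complex.sq_norm, Complex.normSq_add_mul_I]; ring
  rw [← e3, Real.log_pow, auxH]
  push_cast
  ring

/-- `∫_0^{π/2} ln(x² + ln²(2 cos x)) cos 2x dx = −π/4`. -/
theorem integral_log_sq_add_log_sq_two_cos_mul_cos :
    ∫ x in (0:ℝ)..(π/2),
        Real.log (x ^ 2 + Real.log (2 * Real.cos x) ^ 2) * Real.cos (2 * x)
    = -π / 4 := by
  have h : ∫ x in (0:ℝ)..(π/2),
        Real.log (x ^ 2 + Real.log (2 * Real.cos x) ^ 2) * Real.cos (2 * x)
      = ∫ x in (0:ℝ)..(π/2), 2 * auxH (2 * x) := by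
    apply intervalIntegral.integral_congr_ae
    have : ∀ᵐ θ : ℝ, θ ≠ π / 2 := by simp [MeasureTheory.ae_iff]
    filter_upwards [this] with x hx hm
    rw [Set.uIoc_of_le (by positivity)] at hm
    exact aux_integrand hm.1 (lt_of_le_of_ne hm.2 hx)
  rw [h, intervalIntegral.integral_const_mul, intervalIntegral.mul_integral_comp_mul_left,
    mul_zero, show 2 * (π / 2) = π by ring, auxH_half]
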